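/- Let f = G·(T_1 + T_2), where G, T_1, T_2 ∈ F[x_1,…,x_n] are products of linear forms, T_1 and T_2 are homogeneous of equal positive degree, and T_1 and T_2 have no common linear factor (gcd(T_1,T_2) = 1). Fix i ∈ {1,2}, let ℓ be a linear form dividing T_i, and let ℓ′ be a linear form dividing T_1·T_2 with ℓ and ℓ′ linearly independent. Assume (H1) every linear factor of T_1·T_2 lying in span{ℓ, ℓ′} is a scalar multiple of ℓ or of ℓ′, and (H2) no linear factor of T_1 + T_2 lies in span{ℓ, ℓ′}. Then NonLin(f) vanishes on the codimension-2 subspace V(ℓ, ℓ′) if and only if ℓ′ divides T_{3−i}. -/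

import Mathlib

open MvPolynomial

/-- A linear form: a nonzero homogeneous degree-1 polynomial. -/
def IsLinearForm {F : Type*} [Field F] {n : ℕ} (ℓ : MvPolynomial (Fin n) F) : Prop :=
  ℓ ≠ 0 ∧ ℓ.IsHomogeneous 1

/-- A product of linear forms (a nonzero scalar multiple of a product of linear forms). -/
def IsProdLinearForms {F : Type*} [Field F] {n : ℕ} (g : MvPolynomial (Fin n) F) : Prop :=
  ∃ (c : F) (L : Multiset (MvPolynomial (Fin n) F)),
    c ≠ 0 ∧ (∀ p ∈ L, IsLinearForm p) ∧ g = c • L.prod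

/-- `g` has no linear factors. -/
def NoLinearFactor {F : Type*} [Field F] {n : ℕ} (g : MvPolynomial (Fin n) F) : Prop :=
  ∀ ℓ : MvPolynomial (Fin n) F, IsLinearForm ℓ → ¬ ℓ ∣ g

/-- `h` is the non-linear part `NonLin(f)` of `f` (up to scalars): `h` has no linear
factors and `f` is a product of linear forms times `h`. -/
def IsNonLinPart {F : Type*} [Field F] {n : ℕ} (f h : MvPolynomial (Fin n) F) : Prop :=
  NoLinearFactor h ∧ ∃ L : MvPolynomial (Fin n) F, IsProdLinearForms L ∧ f = L * h

/-- `S(g)`: the set of codimension-2 subspaces `V(ℓ₁,ℓ₂)` of `F^n` on which `g`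
vanishes, i.e. `g` belongs to the ideal generated by `ℓ₁, ℓ₂`. -/
def vanishCodim2 {F : Type*} [Field F] {n : ℕ} (g : MvPolynomial (Fin n) F) :
    Set (Set (Fin n → F)) :=
  {W | ∃ ℓ₁ ℓ₂ : MvPolynomial (Fin n) F, IsLinearForm ℓ₁ ∧ IsLinearForm ℓ₂ ∧
    LinearIndependent F ![ℓ₁, ℓ₂] ∧
    W = {a : Fin n → F | eval a ℓ₁ = 0 ∧ eval a ℓ₂ = 0} ∧
    g ∈ Ideal.span {ℓ₁, ℓ₂}}

/-- For linear forms `s`, the endomorphism of the polynomial ring induced by a linear projection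
along the span of `s` has kernel the ideal generated by `s`. -/
theorem exists_algHom_ker_eq_span_linear {F : Type*} [Field F] {n : ℕ}
    (s : Set (MvPolynomial (Fin n) F)) (hs : ∀ p ∈ s, p.IsHomogeneous 1) :
    ∃ ψ : MvPolynomial (Fin n) F →ₐ[F] MvPolynomial (Fin n) F,
      RingHom.ker ψ = Ideal.span s ∧
      ∀ u : MvPolynomial (Fin n) F, u.IsHomogeneous 1 → ψ u = 0 → u ∈ Submodule.span F s := by
  obtain ⟨P, hP⟩ := LinearMap.exists_leftInverse_of_injective (Submodule.span F s).subtype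
    (Submodule.ker_subtype _)
  let ψ : MvPolynomial (Fin n) F →ₐ[F] MvPolynomial (Fin n) F :=
    aeval fun i => X i - (P (X i) : MvPolynomial (Fin n) F)
  have span_le : ∀ w ∈ Submodule.span F s, w ∈ Ideal.span s := fun w hw =>
    Submodule.span_le_restrictScalars F (MvPolynomial (Fin n) F) s hw
  have hψ_linear : ∀ u : MvPolynomial (Fin n) F, u.IsHomogeneous 1 →
      ψ u = u - (P u : MvPolynomial (Fin n) F) := by
    intro u hu
    refine LinearMap.eqOn_span (s := Set.range X) (f := ψ.toLinearMap)
      (g := LinearMap.id - (Submodule.span F s).subtype ∘ₗ P) ?_ ?_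
    · rintro _ ⟨i, rfl⟩
      simp [ψ]
    · rwa [← homogeneousSubmodule_one_eq_span_X, mem_homogeneousSubmodule]
  have hψ_mod : ∀ p, p - ψ p ∈ Ideal.span s := by
    intro p
    rw [← Ideal.Quotient.eq]
    have h : (Ideal.Quotient.mkₐ F (Ideal.span s)) =
        (Ideal.Quotient.mkₐ F (Ideal.span s)).comp ψ := by
      ext i
      simp only [AlgHom.comp_apply, ψ, aeval_X, Ideal.Quotient.mkₐ_eq_mk]
      rw [Ideal.Quotient.eq]
      simpa using span_le _ (P (X i)).2
    exact DFunLike.congr_fun h p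
  have hP_mem : ∀ w (hw : w ∈ Submodule.span F s), (P w : MvPolynomial (Fin n) F) = w :=
    fun w hw => congrArg Subtype.val (DFunLike.congr_fun hP ⟨w, hw⟩)
  refine ⟨ψ, le_antisymm (fun p hp => ?_) (Ideal.span_le.2 fun p hp => ?_), fun u hu hu0 => ?_⟩
  · simpa [(RingHom.mem_ker).1 hp] using hψ_mod p
  · change ψ p = 0
    rw [hψ_linear p (hs p hp), hP_mem p (Submodule.subset_span hp), sub_self]
  · rw [hψ_linear u hu, sub_eq_zero] at hu0
    rw [hu0]
    exact (P u).2

theorem isPrime_span_of_isHomogeneous_one {F : Type*} [Field F] {n : ℕ}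
    {s : Set (MvPolynomial (Fin n) F)} (hs : ∀ p ∈ s, p.IsHomogeneous 1) :
    (Ideal.span s).IsPrime := by
  obtain ⟨ψ, hψ, -⟩ := exists_algHom_ker_eq_span_linear s hs
  rw [← hψ]
  exact RingHom.ker_isPrime ψ

theorem mem_span_of_mem_idealSpan_of_isHomogeneous_one {F : Type*} [Field F] {n : ℕ}
    {s : Set (MvPolynomial (Fin n) F)} (hs : ∀ p ∈ s, p.IsHomogeneous 1)
    {u : MvPolynomial (Fin n) F} (hu : u.IsHomogeneous 1) (hus : u ∈ Ideal.span s) :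
    u ∈ Submodule.span F s := by
  obtain ⟨ψ, hψ, h⟩ := exists_algHom_ker_eq_span_linear s hs
  rw [← hψ] at hus
  exact h u hu hus

theorem IsLinearForm.prime {F : Type*} [Field F] {n : ℕ} {ℓ : MvPolynomial (Fin n) F}
    (hℓ : IsLinearForm ℓ) : Prime ℓ :=
  (Ideal.span_singleton_prime hℓ.1).1 <| isPrime_span_of_isHomogeneous_one <| by
    simpa using hℓ.2

theorem IsProdLinearForms.ne_zero {F : Type*} [Field F] {n : ℕ} {g : MvPolynomial (Fin n) F}
    (hg : IsProdLinearForms g) : g ≠ 0 := by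
  obtain ⟨c, L, hc, hL, rfl⟩ := hg
  exact smul_ne_zero hc (Multiset.prod_ne_zero fun h => (hL 0 h).1 rfl)

/-- A prime dividing a product of linear forms is associated to a linear form. -/
theorem IsProdLinearForms.exists_associated_of_prime_dvd {F : Type*} [Field F] {n : ℕ}
    {g q : MvPolynomial (Fin n) F} (hg : IsProdLinearForms g) (hq : Prime q) (hqg : q ∣ g) :
    ∃ p, IsLinearForm p ∧ Associated q p := by
  obtain ⟨c, L, hc, hL, rfl⟩ := hg
  rw [smul_eq_C_mul] at hqg
  have hqL : q ∣ L.prod := (hq.dvd_or_dvd hqg).resolve_left fun h =>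
    hq.not_isUnit (isUnit_of_dvd_unit h (hc.isUnit.map C))
  obtain ⟨p, hp, hqp⟩ := hq.exists_mem_multiset_dvd hqL
  exact ⟨p, hL p hp, hq.associated_of_dvd (hL p hp).prime hqp⟩

/-- A divisor of a product of linear forms lying in a prime ideal has a linear factor in it. -/
theorem IsProdLinearForms.exists_linear_dvd_mem {F : Type*} [Field F] {n : ℕ}
    {g M : MvPolynomial (Fin n) F} (hg : IsProdLinearForms g) (hMg : M ∣ g)
    {I : Ideal (MvPolynomial (Fin n) F)} (hI : I.IsPrime) (hM : M ∈ I) :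
    ∃ p, IsLinearForm p ∧ p ∣ M ∧ p ∈ I := by
  have hM0 : M ≠ 0 := ne_zero_of_dvd_ne_zero hg.ne_zero hMg
  obtain ⟨s, hs, hsM⟩ := UniqueFactorizationMonoid.exists_prime_factors M hM0
  have hsI : s.prod ∈ I := (I.mem_iff_of_associated hsM).2 hM
  obtain ⟨q, hqs, hqI⟩ := hI.multiset_prod_mem_iff_exists_mem s |>.1 hsI
  have hqM : q ∣ M := (Multiset.dvd_prod hqs).trans hsM.dvd
  obtain ⟨p, hp, hqp⟩ := hg.exists_associated_of_prime_dvd (hs q hqs) (hqM.trans hMg)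
  exact ⟨p, hp, hqp.dvd'.trans hqM, I.mem_of_dvd hqp.dvd hqI⟩

/-- Up to linear factors, the non-linear part of `G * S` is a factor of `S`. -/
theorem IsNonLinPart.exists_cofactor {F : Type*} [Field F] {n : ℕ}
    {G S h : MvPolynomial (Fin n) F} (hG : IsProdLinearForms G) (hh : IsNonLinPart (G * S) h) :
    ∃ M L, IsProdLinearForms L ∧ M ∣ L ∧ S = M * h := by
  obtain ⟨hlin, L, hL, hLh⟩ := hh
  have hrel : IsRelPrime h G := by
    refine (UniqueFactorizationMonoid.isRelPrime_iff_no_prime_factors hG.ne_zero).2 ?_ |>.symm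
    intro d hdG hdh hd
    obtain ⟨p, hp, hdp⟩ := hG.exists_associated_of_prime_dvd hd hdG
    exact hlin p hp (hdp.dvd'.trans hdh)
  obtain ⟨M, rfl⟩ := hrel.dvd_of_dvd_mul_left (Dvd.intro_left L hLh.symm)
  by_cases h0 : h = 0
  · exact ⟨1, L, hL, one_dvd L, by simp [h0]⟩
  refine ⟨M, L, hL, ⟨G, mul_right_cancel₀ h0 ?_⟩, mul_comm _ _⟩
  rw [← hLh]
  ring

/-- Let `ℓ ∣ Tᵢ` and `ℓ' ∣ T₁·T₂` be independent linear forms such that (H1) every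
linear factor of `T₁·T₂` in `span{ℓ,ℓ'}` is a scalar multiple of `ℓ` or `ℓ'`, and
(H2) no linear factor of `T₁+T₂` lies in `span{ℓ,ℓ'}`.  Then `NonLin(f)` vanishes on
`V(ℓ,ℓ')` iff `ℓ'` divides the other gate. -/
theorem nonlin_vanishes_iff_divides_other_gate
    {F : Type*} [Field F] [Fintype F] {n m : ℕ}
    (G T₁ T₂ f h : MvPolynomial (Fin n) F)
    (hm : 0 < m)
    (hG : IsProdLinearForms G) (hT₁ : IsProdLinearForms T₁) (hT₂ : IsProdLinearForms T₂)
    (hT₁hom : T₁.IsHomogeneous m) (hT₂hom : T₂.IsHomogeneous m)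
    (hgcd : ∀ ℓ : MvPolynomial (Fin n) F, IsLinearForm ℓ → ℓ ∣ T₁ → ¬ ℓ ∣ T₂)
    (hf : f = G * (T₁ + T₂)) (hh : IsNonLinPart f h)
    (A B ℓ ℓ' : MvPolynomial (Fin n) F)
    (hAB : (A = T₁ ∧ B = T₂) ∨ (A = T₂ ∧ B = T₁))
    (hℓ : IsLinearForm ℓ) (hℓA : ℓ ∣ A)
    (hℓ' : IsLinearForm ℓ') (hℓ'T : ℓ' ∣ T₁ * T₂)
    (hind : LinearIndependent F ![ℓ, ℓ'])
    (H1 : ∀ u : MvPolynomial (Fin n) F, IsLinearForm u → u ∣ T₁ * T₂ →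
      u ∈ Submodule.span F ({ℓ, ℓ'} : Set (MvPolynomial (Fin n) F)) →
      (∃ c : F, u = c • ℓ) ∨ (∃ c : F, u = c • ℓ'))
    (H2 : ∀ u : MvPolynomial (Fin n) F, IsLinearForm u → u ∣ T₁ + T₂ →
      u ∉ Submodule.span F ({ℓ, ℓ'} : Set (MvPolynomial (Fin n) F))) :
    h ∈ Ideal.span {ℓ, ℓ'} ↔ ℓ' ∣ B := by
  subst hf
  obtain ⟨M, L, hL, hML, hS⟩ := hh.exists_cofactor hG
  have hs : ∀ p ∈ ({ℓ, ℓ'} : Set (MvPolynomial (Fin n) F)), p.IsHomogeneous 1 := by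
    rintro p (rfl | rfl)
    exacts [hℓ.2, hℓ'.2]
  have hI := isPrime_span_of_isHomogeneous_one hs
  have hBprod : IsProdLinearForms B := by
    rcases hAB with ⟨-, rfl⟩ | ⟨-, rfl⟩ <;> assumption
  have hsum : T₁ + T₂ = A + B := by
    rcases hAB with ⟨rfl, rfl⟩ | ⟨rfl, rfl⟩
    exacts [rfl, add_comm _ _]
  have hBT : B ∣ T₁ * T₂ := by
    rcases hAB with ⟨-, rfl⟩ | ⟨-, rfl⟩
    exacts [dvd_mul_left _ _, dvd_mul_right _ _]
  have hℓB : ¬ ℓ ∣ B := by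
    rcases hAB with ⟨rfl, rfl⟩ | ⟨rfl, rfl⟩
    exacts [hgcd ℓ hℓ hℓA, fun h => hgcd ℓ hℓ h hℓA]
  have hA : A ∈ Ideal.span {ℓ, ℓ'} :=
    Ideal.mem_of_dvd _ hℓA (Ideal.subset_span (Set.mem_insert _ _))
  constructor
  · intro hhI
    have hB : B ∈ Ideal.span {ℓ, ℓ'} := by
      rw [← Ideal.add_mem_iff_right _ hA, ← hsum, hS]
      exact Ideal.mul_mem_left _ _ hhI
    obtain ⟨p, hp, hpB, hpI⟩ := hBprod.exists_linear_dvd_mem dvd_rfl hI hB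
    rcases H1 p hp (hpB.trans hBT)
      (mem_span_of_mem_idealSpan_of_isHomogeneous_one hs hp.2 hpI) with ⟨c, rfl⟩ | ⟨c, rfl⟩
    · exact absurd ((dvd_smul_of_dvd c dvd_rfl).trans hpB) hℓB
    · exact (dvd_smul_of_dvd c dvd_rfl).trans hpB
  · intro hℓ'B
    have hB : B ∈ Ideal.span {ℓ, ℓ'} :=
      Ideal.mem_of_dvd _ hℓ'B (Ideal.subset_span (Set.mem_insert_of_mem _ rfl))
    have hMh : M * h ∈ Ideal.span {ℓ, ℓ'} := by
      rw [← hS, hsum]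
      exact Ideal.add_mem _ hA hB
    refine (hI.mem_or_mem hMh).resolve_left fun hM => ?_
    obtain ⟨p, hp, hpM, hpI⟩ := hL.exists_linear_dvd_mem hML hI hM
    exact H2 p hp (hS ▸ hpM.mul_right h)
      (mem_span_of_mem_idealSpan_of_isHomogeneous_one hs hp.2 hpI)
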